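/- Let (X, ℝ, α) be a nontrivial one-parameter C*-dynamical system such that X^α([0,∞)) is a maximal norm-closed subalgebra of X, and let Y be a norm-closed α-invariant α-simple two-sided ideal of X with Y^α((0,∞)) = X^α((0,∞)) and Y + X^α([0,∞)) norm-dense in X. Then the closed linear span of X^α((−∞,0)) X X^α((0,∞)) is contained in Y^α = Y ∩ X^α if and only if the closed linear span of X^α((0,∞)) X X^α((−∞,0)) is contained in Y^α. -/

import Mathlib

open MeasureTheory Set Filter Topology Pointwise

noncomputable section

namespace PeligradMax

variable {X : Type*} [NonUnitalNormedRing X] [StarRing X] [CStarRing X]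
  [NormedSpace ℂ X] [IsScalarTower ℂ X X] [SMulCommClass ℂ X X] [StarModule ℂ X]
  [CompleteSpace X] [PartialOrder X] [StarOrderedRing X]

/-- A one-parameter C*-dynamical system: a group of *-automorphisms of `X`
with norm-continuous orbit maps. -/
structure IsCStarDynSys (α : ℝ → X → X) : Prop where
  map_zero_time : ∀ x, α 0 x = x
  map_add_time : ∀ s t x, α (s + t) x = α s (α t x)
  map_add : ∀ t x y, α t (x + y) = α t x + α t y
  map_smulc : ∀ (t : ℝ) (c : ℂ) (x : X), α t (c • x) = c • α t x
  map_mul : ∀ t x y, α t (x * y) = α t x * α t y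
  map_star : ∀ t x, α t (star x) = star (α t x)
  continuous_orbit : ∀ x, Continuous fun t => α t x

/-- Closed linear span. -/
def ClosedSpan (S : Set X) : Set X := closure ((Submodule.span ℂ S : Submodule ℂ X) : Set X)

def MulSet2 (S T : Set X) : Set X := {z | ∃ s ∈ S, ∃ t ∈ T, z = s * t}

def MulSet3 (S T R : Set X) : Set X := {z | ∃ s ∈ S, ∃ t ∈ T, ∃ r ∈ R, z = s * t * r}

/-- Fourier transform of an integrable function. -/
def fourierT (f : ℝ → ℂ) (γ : ℝ) : ℂ := ∫ t : ℝ, f t * Complex.exp (-(Complex.I * γ * t))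

/-- `α_f(x) = ∫ f(t) α_t(x) dt`. -/
def smear (α : ℝ → X → X) (f : ℝ → ℂ) (x : X) : X := ∫ t : ℝ, f t • α t x

/-- Arveson spectrum of an element. -/
def elemSpec (α : ℝ → X → X) (x : X) : Set ℝ :=
  {γ | ∀ f : ℝ → ℂ, Integrable f → smear α f x = 0 → fourierT f γ = 0}

/-- Spectral subspace associated with a closed set `F ⊆ ℝ`. -/
def specC (α : ℝ → X → X) (F : Set ℝ) : Set X := {x | elemSpec α x ⊆ F}

/-- Spectral subspace of the subset `S` associated with an open set `U ⊆ ℝ`. -/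
def specO (α : ℝ → X → X) (S : Set X) (U : Set ℝ) : Set X :=
  ClosedSpan {y | ∃ x ∈ S, ∃ f : ℝ → ℂ, Integrable f ∧
    IsCompact (tsupport (fourierT f)) ∧ tsupport (fourierT f) ⊆ U ∧ y = smear α f x}

/-- The fixed point algebra `X^α`. -/
def fixedPts (α : ℝ → X → X) : Set X := {x | ∀ t, α t x = x}

/-- The Arveson spectrum of the action restricted to `S`. -/
def actSpec (α : ℝ → X → X) (S : Set X) : Set ℝ :=
  {γ : ℝ | ∀ ε > (0 : ℝ), S ∩ specC α (Icc (γ - ε) (γ + ε)) ≠ ({0} : Set X)}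

def Invariant (α : ℝ → X → X) (S : Set X) : Prop := ∀ t : ℝ, ∀ x ∈ S, α t x ∈ S

def IsSubalgebra (B : Set X) : Prop :=
  (0 : X) ∈ B ∧ (∀ x ∈ B, ∀ y ∈ B, x + y ∈ B) ∧
  (∀ c : ℂ, ∀ x ∈ B, c • x ∈ B) ∧ ∀ x ∈ B, ∀ y ∈ B, x * y ∈ B

def IsStarSubalgebra (B : Set X) : Prop := IsSubalgebra B ∧ ∀ x ∈ B, star x ∈ B

/-- `B` is a hereditary C*-subalgebra of the subset `S`. -/
def IsHereditaryIn (S B : Set X) : Prop :=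
  B ⊆ S ∧ IsClosed B ∧ IsStarSubalgebra B ∧
  ∀ x ∈ S, ∀ b ∈ B, 0 ≤ x → x ≤ b → x ∈ B

/-- `K` is a norm-closed two-sided ideal of the subset `S`. -/
def IsClosedTwoSidedIdealIn (S K : Set X) : Prop :=
  K ⊆ S ∧ IsClosed K ∧ (0 : X) ∈ K ∧ (∀ x ∈ K, ∀ y ∈ K, x + y ∈ K) ∧
  (∀ c : ℂ, ∀ x ∈ K, c • x ∈ K) ∧ ∀ s ∈ S, ∀ k ∈ K, s * k ∈ K ∧ k * s ∈ K

/-- `S` is `α`-simple: no nontrivial norm-closed `α`-invariant two-sided ideals. -/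
def AlphaSimple (α : ℝ → X → X) (S : Set X) : Prop :=
  ∀ K : Set X, IsClosedTwoSidedIdealIn S K → Invariant α K → K = ({0} : Set X) ∨ K = S

/-- The strong Arveson spectrum of the action restricted to `B`. -/
def strongSpec (α : ℝ → X → X) (B : Set X) : Set ℝ :=
  {γ : ℝ | ∀ ε > (0 : ℝ),
    ClosedSpan (MulSet3 (star '' (B ∩ specC α (Icc (γ - ε) (γ + ε)))) B
      (B ∩ specC α (Icc (γ - ε) (γ + ε)))) = B}

/-- The strong Connes spectrum of the action restricted to `S`. -/
def ConnesSpec (α : ℝ → X → X) (S : Set X) : Set ℝ :=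
  ⋂ B ∈ {B : Set X | IsHereditaryIn S B ∧ B ≠ ({0} : Set X) ∧ Invariant α B},
    strongSpec α B

def IsMaximalClosedSubalgebra (B : Set X) : Prop :=
  IsClosed B ∧ IsSubalgebra B ∧ B ≠ (univ : Set X) ∧
  ∀ W : Set X, IsClosed W → IsSubalgebra W → B ⊆ W → W = B ∨ W = univ

/-- The spectral Condition 4.3. -/
def Condition43 (α : ℝ → X → X) : Prop :=
  (∃ γ₀ : ℝ, 0 < γ₀ ∧ actSpec α (univ : Set X) = ({-γ₀, 0, γ₀} : Set ℝ) ∧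
    IsClosedTwoSidedIdealIn (fixedPts α)
      (ClosedSpan (MulSet2 (specC α ({γ₀} : Set ℝ)) (star '' specC α ({γ₀} : Set ℝ)))) ∧
    ∀ K : Set X,
      IsClosedTwoSidedIdealIn
        (ClosedSpan (MulSet2 (specC α ({γ₀} : Set ℝ)) (star '' specC α ({γ₀} : Set ℝ)))) K →
      K = ({0} : Set X) ∨
        K = ClosedSpan (MulSet2 (specC α ({γ₀} : Set ℝ)) (star '' specC α ({γ₀} : Set ℝ)))) ∨
  (∃ Y : Set X, IsClosedTwoSidedIdealIn (univ : Set X) Y ∧ Invariant α Y ∧ AlphaSimple α Y ∧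
    specO α Y (Ioi (0 : ℝ)) = specO α (univ : Set X) (Ioi (0 : ℝ)) ∧
    actSpec α Y = ConnesSpec α Y ∧
    closure (Y + specC α (Ici (0 : ℝ))) = (univ : Set X))

set_option linter.unusedSectionVars false

section Orbit

variable {α : ℝ → X → X}

theorem closedSpan_induction {S : Set X} {p : X → Prop} (hcl : IsClosed {x | p x})
    (mem : ∀ x ∈ S, p x) (zero : p 0) (add_closed : ∀ x y, p x → p y → p (x + y))
    (smul : ∀ (c : ℂ) x, p x → p (c • x)) {x : X} (hx : x ∈ ClosedSpan S) : p x := by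
  have h : ((Submodule.span ℂ S : Submodule ℂ X) : Set X) ⊆ {x | p x} := fun y hy =>
    Submodule.span_induction (p := fun y _ => p y) mem zero (fun x y _ _ => add_closed x y)
      (fun c x _ => smul c x) hy
  exact closure_minimal h hcl hx

theorem subset_closedSpan (S : Set X) : S ⊆ ClosedSpan S :=
  Submodule.subset_span.trans subset_closure

theorem closedSpan_eq_coe (S : Set X) :
    ClosedSpan S = ((Submodule.span ℂ S).topologicalClosure : Set X) := by
  rw [Submodule.topologicalClosure_coe]; rfl

theorem isClosed_closedSpan (S : Set X) : IsClosed (ClosedSpan S) := isClosed_closure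

theorem zero_mem_closedSpan (S : Set X) : (0 : X) ∈ ClosedSpan S := by
  rw [closedSpan_eq_coe]; exact zero_mem _

theorem add_mem_closedSpan {S : Set X} {x y : X} (hx : x ∈ ClosedSpan S)
    (hy : y ∈ ClosedSpan S) : x + y ∈ ClosedSpan S := by
  rw [closedSpan_eq_coe] at *; exact add_mem hx hy

theorem smul_mem_closedSpan {S : Set X} (c : ℂ) {x : X} (hx : x ∈ ClosedSpan S) :
    c • x ∈ ClosedSpan S := by
  rw [closedSpan_eq_coe] at *; exact Submodule.smul_mem _ c hx

namespace IsCStarDynSys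

/-- The automorphism at time `t` as a star homomorphism. -/
def starHom (hα : IsCStarDynSys α) (t : ℝ) : X →⋆ₙₐ[ℂ] X where
  toFun := α t
  map_smul' c x := hα.map_smulc t c x
  map_zero' := by simpa using hα.map_smulc t 0 0
  map_add' := hα.map_add t
  map_mul' := hα.map_mul t
  map_star' := hα.map_star t

theorem norm_apply_le (hα : IsCStarDynSys α) (t : ℝ) (x : X) : ‖α t x‖ ≤ ‖x‖ :=
  letI : NonUnitalCStarAlgebra X := { }
  NonUnitalStarAlgHom.norm_apply_le (hα.starHom t) x

/-- The automorphism at time `t` as a continuous linear map. -/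
def toCLM (hα : IsCStarDynSys α) (t : ℝ) : X →L[ℂ] X :=
  LinearMap.mkContinuous
    { toFun := α t, map_add' := hα.map_add t, map_smul' := hα.map_smulc t } 1
    fun x => by simpa using hα.norm_apply_le t x

theorem toCLM_apply (hα : IsCStarDynSys α) (t : ℝ) (x : X) : hα.toCLM t x = α t x := rfl

theorem integrable_smul_comp (hα : IsCStarDynSys α) {f : ℝ → ℂ} (hf : Integrable f)
    {g : ℝ → ℝ} (hg : Continuous g) (x : X) : Integrable fun t => f t • α (g t) x := by
  refine (hf.norm.mul_const ‖x‖).mono'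
    (hf.1.smul ((hα.continuous_orbit x).comp hg).aestronglyMeasurable) (ae_of_all _ fun t => ?_)
  rw [norm_smul]
  exact mul_le_mul_of_nonneg_left (hα.norm_apply_le _ _) (norm_nonneg _)

theorem integrable_smul (hα : IsCStarDynSys α) {f : ℝ → ℂ} (hf : Integrable f) (x : X) :
    Integrable fun t => f t • α t x :=
  hα.integrable_smul_comp hf continuous_id x

theorem map_smear (hα : IsCStarDynSys α) {f : ℝ → ℂ} (hf : Integrable f) (s : ℝ) (x : X) :
    α s (smear α f x) = smear α f (α s x) := by
  rw [smear, ← hα.toCLM_apply, ← (hα.toCLM s).integral_comp_comm (hα.integrable_smul hf x)]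
  refine integral_congr_ae (ae_of_all _ fun t => ?_)
  simp only [map_smul, toCLM_apply]
  rw [← hα.map_add_time, ← hα.map_add_time, add_comm]

theorem mul_smear (hα : IsCStarDynSys α) {f : ℝ → ℂ} (hf : Integrable f) (m x : X) :
    m * smear α f x = ∫ t, f t • (m * α t x) := by
  have h := (ContinuousLinearMap.mul ℂ X m).integral_comp_comm (hα.integrable_smul hf x)
  simpa [smear] using h.symm

theorem smear_mul (hα : IsCStarDynSys α) {f : ℝ → ℂ} (hf : Integrable f) (m x : X) :
    smear α f x * m = ∫ t, f t • (α t x * m) := by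
  have h := ((ContinuousLinearMap.mul ℂ X).flip m).integral_comp_comm (hα.integrable_smul hf x)
  simpa [smear] using h.symm

theorem mul_smear_of_fixed (hα : IsCStarDynSys α) {f : ℝ → ℂ} (hf : Integrable f) {m : X}
    (hm : m ∈ fixedPts α) (x : X) : m * smear α f x = smear α f (m * x) := by
  rw [hα.mul_smear hf, smear]
  refine integral_congr_ae (ae_of_all _ fun t => ?_)
  simp only [hα.map_mul, hm t]

theorem smear_mem (hα : IsCStarDynSys α) {f : ℝ → ℂ} (hf : Integrable f) (M : Submodule ℂ X)
    (hM : IsClosed (M : Set X)) {x : X} (hx : ∀ t, α t x ∈ M) : smear α f x ∈ M := by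
  have : IsClosed (M : Set X) := hM
  have h := M.mkQL.integral_comp_comm (hα.integrable_smul hf x)
  rw [← Submodule.Quotient.mk_eq_zero]
  change M.mkQL (∫ t, f t • α t x) = 0
  rw [← h]
  refine integral_eq_zero_of_ae (ae_of_all _ fun t => ?_)
  simpa using Or.inr (hx t)

theorem smear_add_fun (hα : IsCStarDynSys α) {f g : ℝ → ℂ} (hf : Integrable f)
    (hg : Integrable g) (x : X) : smear α (fun t => f t + g t) x = smear α f x + smear α g x := by
  simp only [smear, add_smul]
  exact integral_add (hα.integrable_smul hf x) (hα.integrable_smul hg x)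

theorem map_zero (hα : IsCStarDynSys α) (t : ℝ) : α t 0 = 0 := (hα.toCLM t).map_zero

theorem isClosed_fixedPts (hα : IsCStarDynSys α) : IsClosed (fixedPts α) := by
  simp only [fixedPts, ofPred_forall]
  exact isClosed_iInter fun t => isClosed_eq (hα.toCLM t).continuous continuous_id

theorem star_smear (hα : IsCStarDynSys α) (f : ℝ → ℂ) (x : X) :
    star (smear α f x) = smear α (fun t => star (f t)) (star x) := by
  have h := (starL' ℝ (A := X)).integral_comp_comm (μ := volume)
    (fun t => f t • α t x)
  rw [smear, smear]
  refine Eq.trans ?_ (h.symm.trans ?_)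
  · rfl
  · refine integral_congr_ae (ae_of_all _ fun t => ?_)
    simp [hα.map_star]

end IsCStarDynSys

theorem fourierT_star (f : ℝ → ℂ) (γ : ℝ) :
    fourierT (fun t => star (f t)) γ = star (fourierT f (-γ)) := by
  simp only [fourierT]
  change _ = (starRingEnd ℂ) _
  rw [← integral_conj]
  refine integral_congr_ae (ae_of_all _ fun t => ?_)
  simp [← Complex.exp_conj]

theorem star_mem_specO (hα : IsCStarDynSys α) {U V : Set ℝ} (hUV : ∀ γ ∈ U, -γ ∈ V) {x : X}
    (hx : x ∈ specO α univ U) : star x ∈ specO α univ V := by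
  refine closedSpan_induction (p := fun x => star x ∈ specO α univ V)
    ((isClosed_closedSpan _).preimage continuous_star) ?_ ?_ ?_ ?_ hx
  · rintro _ ⟨x, -, f, hf, hc, hs, rfl⟩
    rw [hα.star_smear]
    have he : fourierT (fun t => star (f t)) = star ∘ fourierT f ∘ (Homeomorph.neg ℝ) := by
      funext γ; exact fourierT_star f γ
    have hsup : tsupport (fourierT fun t => star (f t)) =
        (Homeomorph.neg ℝ) ⁻¹' tsupport (fourierT f) := by
      rw [he, tsupport, Function.support_comp_eq star (by simp), ← tsupport,
        tsupport_comp_eq_preimage]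
    refine subset_closedSpan _ ⟨star x, mem_univ _, _, ?_, ?_, ?_, rfl⟩
    · exact (starL' ℝ (A := ℂ)).integrable_comp_iff.2 hf
    · rw [hsup]; exact (Homeomorph.neg ℝ).isCompact_preimage.2 hc
    · rw [hsup]; intro γ hγ; simpa using hUV _ (hs hγ)
  · rw [star_zero]; exact zero_mem_closedSpan _
  · intro x y hx hy; rw [star_add]; exact add_mem_closedSpan hx hy
  · intro c x hx; rw [star_smul]; exact smul_mem_closedSpan (star c) hx

theorem map_mem_specO (hα : IsCStarDynSys α) {U : Set ℝ} {x : X}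
    (hx : x ∈ specO α univ U) (s : ℝ) : α s x ∈ specO α univ U := by
  refine closedSpan_induction (p := fun x => α s x ∈ specO α univ U)
    ((isClosed_closedSpan _).preimage (hα.toCLM s).continuous) ?_ ?_ ?_ ?_ hx
  · rintro _ ⟨x, -, f, hf, hc, hs, rfl⟩
    rw [hα.map_smear hf]
    exact subset_closedSpan _ ⟨_, mem_univ _, f, hf, hc, hs, rfl⟩
  · rw [hα.map_zero]; exact zero_mem_closedSpan _
  · intro x y hx hy; rw [hα.map_add]; exact add_mem_closedSpan hx hy
  · intro c x hx; rw [hα.map_smulc]; exact smul_mem_closedSpan c hx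

end Orbit

section Kernel

open scoped SchwartzMap FourierTransform ContDiff

variable {α : ℝ → X → X}

/-- The average of the orbit of `x`, run at speed `μ`, against the weight `k`. -/
def dilAvg (α : ℝ → X → X) (k : ℝ → ℂ) (μ : ℝ) (x : X) : X := ∫ u : ℝ, k u • α (μ * u) x

theorem dilAvg_of_fixed {k : ℝ → ℂ} (hk : ∫ u, k u = 1) (μ : ℝ) {x : X}
    (hx : x ∈ fixedPts α) : dilAvg α k μ x = x := by
  have : (fun u => k u • α (μ * u) x) = fun u => k u • x := by
    funext u; rw [hx]
  rw [dilAvg, this, integral_smul_const, hk, one_smul]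

theorem IsCStarDynSys.norm_dilAvg_le (hα : IsCStarDynSys α) {k : ℝ → ℂ} (hk : Integrable k)
    (μ : ℝ) (x : X) : ‖dilAvg α k μ x‖ ≤ (∫ u, ‖k u‖) * ‖x‖ := by
  rw [← integral_mul_const]
  refine norm_integral_le_of_norm_le (hk.norm.mul_const _) (ae_of_all _ fun u => ?_)
  rw [norm_smul]
  exact mul_le_mul_of_nonneg_left (hα.norm_apply_le _ _) (norm_nonneg _)

theorem IsCStarDynSys.tendsto_dilAvg_zero (hα : IsCStarDynSys α) {k : ℝ → ℂ}
    (hk : Integrable k) (hk1 : ∫ u, k u = 1) (x : X) :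
    Tendsto (fun μ => dilAvg α k μ x) (𝓝 0) (𝓝 x) := by
  have h0 : dilAvg α k 0 x = x := by
    simp [dilAvg, hα.map_zero_time, integral_smul_const, hk1]
  have : ContinuousAt (fun μ => dilAvg α k μ x) 0 := by
    refine continuousAt_of_dominated (bound := fun u => ‖k u‖ * ‖x‖) ?_ ?_
      (hk.norm.mul_const _) ?_
    · exact Eventually.of_forall fun μ => (hα.integrable_smul_comp hk (by fun_prop) x).1
    · refine Eventually.of_forall fun μ => ae_of_all _ fun u => ?_
      rw [norm_smul]
      exact mul_le_mul_of_nonneg_left (hα.norm_apply_le _ _) (norm_nonneg _)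
    · refine ae_of_all _ fun u => Continuous.continuousAt ?_
      exact continuous_const.smul ((hα.continuous_orbit x).comp (by fun_prop))
  simpa [ContinuousAt, h0] using this

theorem exists_norm_translate_sub_le (k : 𝓢(ℝ, ℂ)) :
    ∃ C : ℝ, ∀ u h : ℝ, |h| ≤ 1 → ‖k (u - h) - k u‖ ≤ C * (1 + u ^ 2)⁻¹ := by
  obtain ⟨C₀, -, h₀⟩ := k.decay 0 0
  obtain ⟨C₂, -, h₂⟩ := k.decay 2 0
  simp only [pow_zero, one_mul, norm_iteratedFDeriv_zero, Real.norm_eq_abs, sq_abs] at h₀ h₂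
  have key : ∀ u h : ℝ, |h| ≤ 1 → ‖k (u - h)‖ * (1 + u ^ 2) ≤ 3 * C₀ + 2 * C₂ := by
    intro u h hh
    have hh2 : h ^ 2 ≤ 1 := by rw [← sq_abs]; exact pow_le_one₀ (abs_nonneg _) hh
    have a := h₀ (u - h)
    have b := h₂ (u - h)
    have c : 1 + u ^ 2 ≤ 3 + 2 * (u - h) ^ 2 := by nlinarith [sq_nonneg (u - 2 * h)]
    nlinarith [mul_le_mul_of_nonneg_left c (norm_nonneg (k (u - h)))]
  refine ⟨2 * (3 * C₀ + 2 * C₂), fun u h hh => ?_⟩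
  have hp : 0 < 1 + u ^ 2 := by positivity
  rw [← div_eq_mul_inv, le_div_iff₀ hp]
  have a := key u h hh
  have b := key u 0 (by simp)
  rw [sub_zero] at b
  nlinarith [mul_le_mul_of_nonneg_right (norm_sub_le (k (u - h)) (k u)) hp.le]

theorem tendsto_integral_norm_translate_sub (k : 𝓢(ℝ, ℂ)) :
    Tendsto (fun h : ℝ => ∫ u, ‖k (u - h) - k u‖) (𝓝 0) (𝓝 0) := by
  obtain ⟨C, hC⟩ := exists_norm_translate_sub_le k
  have : ContinuousAt (fun h : ℝ => ∫ u, ‖k (u - h) - k u‖) 0 := by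
    refine continuousAt_of_dominated (bound := fun u => C * (1 + u ^ 2)⁻¹) ?_ ?_
      (integrable_inv_one_add_sq.const_mul C) ?_
    · refine Eventually.of_forall fun h => Continuous.aestronglyMeasurable ?_
      have := k.continuous
      fun_prop
    · filter_upwards [Metric.closedBall_mem_nhds (0 : ℝ) one_pos] with h hh
      refine ae_of_all _ fun u => ?_
      rw [norm_norm]
      exact hC u h (by simpa using hh)
    · refine ae_of_all _ fun u => Continuous.continuousAt ?_
      have := k.continuous
      fun_prop
  simpa [ContinuousAt] using this

theorem IsCStarDynSys.map_dilAvg_sub (hα : IsCStarDynSys α) (k : 𝓢(ℝ, ℂ)) {μ : ℝ} (hμ : μ ≠ 0)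
    (s : ℝ) (x : X) : ‖α s (dilAvg α k μ x) - dilAvg α k μ x‖ ≤
      (∫ u, ‖k (u - s / μ) - k u‖) * ‖x‖ := by
  have hk : Integrable (k : ℝ → ℂ) := k.integrable
  have h1 : α s (dilAvg α k μ x) = ∫ u, k (u - s / μ) • α (μ * u) x := by
    rw [← integral_add_right_eq_self (fun u => k (u - s / μ) • α (μ * u) x) (s / μ), dilAvg,
      ← hα.toCLM_apply, ← (hα.toCLM s).integral_comp_comm
        (hα.integrable_smul_comp hk (by fun_prop) x)]
    refine integral_congr_ae (ae_of_all _ fun u => ?_)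
    simp only [map_smul, toCLM_apply, add_sub_cancel_right]
    rw [← hα.map_add_time]
    congr 2
    field_simp
    ring
  have hk' : Integrable fun u => k (u - s / μ) := hk.comp_sub_right _
  rw [h1, dilAvg, ← integral_sub (hα.integrable_smul_comp hk' (by fun_prop) x)
    (hα.integrable_smul_comp hk (by fun_prop) x), ← integral_mul_const]
  refine norm_integral_le_of_norm_le ((hk'.sub hk).norm.mul_const _) (ae_of_all _ fun u => ?_)
  rw [← sub_smul, norm_smul]
  exact mul_le_mul_of_nonneg_left (hα.norm_apply_le _ _) (norm_nonneg _)

theorem IsCStarDynSys.tendsto_map_dilAvg_sub (hα : IsCStarDynSys α) (k : 𝓢(ℝ, ℂ)) (s : ℝ)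
    (x : X) : Tendsto (fun μ => α s (dilAvg α k μ x) - dilAvg α k μ x) atTop (𝓝 0) := by
  have h1 : Tendsto (fun μ : ℝ => s / μ) atTop (𝓝 0) := tendsto_const_nhds.div_atTop tendsto_id
  have h2 := ((tendsto_integral_norm_translate_sub k).comp h1).mul_const ‖x‖
  rw [zero_mul] at h2
  refine squeeze_zero_norm' ?_ h2
  filter_upwards [eventually_ne_atTop 0] with μ hμ using hα.map_dilAvg_sub k hμ s x

theorem IsCStarDynSys.dilAvg_smear (hα : IsCStarDynSys α) {k f : ℝ → ℂ} (hk : Integrable k)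
    (hf : Integrable f) (μ : ℝ) (x : X) :
    dilAvg α k μ (smear α f x) = smear α f (dilAvg α k μ x) := by
  let L : X →L[ℂ] X := LinearMap.mkContinuous
    { toFun := dilAvg α k μ
      map_add' := fun y z => by
        simp only [dilAvg, hα.map_add, smul_add]
        exact integral_add (hα.integrable_smul_comp hk (by fun_prop) y)
          (hα.integrable_smul_comp hk (by fun_prop) z)
      map_smul' := fun c y => by
        simp only [dilAvg, hα.map_smulc, RingHom.id_apply]
        rw [← integral_smul]
        exact integral_congr_ae (ae_of_all _ fun u => smul_comm _ _ _) }
    (∫ u, ‖k u‖) fun y => hα.norm_dilAvg_le hk μ y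
  have hL : ∀ y, L y = dilAvg α k μ y := fun y => rfl
  rw [← hL, smear, ← L.integral_comp_comm (hα.integrable_smul hf x), smear]
  refine integral_congr_ae (ae_of_all _ fun t => ?_)
  change L (f t • α t x) = f t • hα.toCLM t (∫ u, k u • α (μ * u) x)
  rw [map_smul, hL, dilAvg,
    ← (hα.toCLM t).integral_comp_comm (hα.integrable_smul_comp hk (by fun_prop) x)]
  congr 1
  refine integral_congr_ae (ae_of_all _ fun u => ?_)
  simp only [map_smul, toCLM_apply]
  rw [← hα.map_add_time, ← hα.map_add_time, add_comm]

/-- A fixed point obtained by smearing with a function of integral zero vanishes. -/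
theorem IsCStarDynSys.smear_eq_zero_of_fixed (hα : IsCStarDynSys α) (k : 𝓢(ℝ, ℂ))
    (hk1 : ∫ u, k u = 1) {f : ℝ → ℂ} (hf : Integrable f) (hf0 : ∫ t, f t = 0) {x : X}
    (hx : smear α f x ∈ fixedPts α) : smear α f x = 0 := by
  have hk : Integrable (k : ℝ → ℂ) := k.integrable
  have key : ∀ μ, smear α f x = ∫ t, f t • (α t (dilAvg α k μ x) - dilAvg α k μ x) := by
    intro μ
    simp only [smul_sub]
    rw [integral_sub (hα.integrable_smul hf _) (hf.smul_const _), integral_smul_const, hf0,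
      zero_smul, sub_zero]
    change _ = smear α f _
    rw [← hα.dilAvg_smear hk hf, dilAvg_of_fixed hk1 μ hx]
  have hlim : Tendsto (fun μ => ∫ t, f t • (α t (dilAvg α k μ x) - dilAvg α k μ x)) atTop
      (𝓝 (∫ t, f t • (0 : X))) := by
    refine tendsto_integral_filter_of_dominated_convergence
      (fun t => ‖f t‖ * (2 * ((∫ u, ‖k u‖) * ‖x‖))) ?_ ?_ (hf.norm.mul_const _) ?_
    · refine Eventually.of_forall fun μ => ?_
      simp only [smul_sub]
      exact ((hα.integrable_smul hf _).sub (hf.smul_const _)).1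
    · refine Eventually.of_forall fun μ => ae_of_all _ fun t => ?_
      rw [norm_smul]
      refine mul_le_mul_of_nonneg_left ((norm_sub_le _ _).trans ?_) (norm_nonneg _)
      have a := hα.norm_apply_le t (dilAvg α k μ x)
      have b := hα.norm_dilAvg_le hk μ x
      linarith
    · exact ae_of_all _ fun t => (hα.tendsto_map_dilAvg_sub k t x).const_smul _
  simp only [← key, smul_zero, integral_zero] at hlim
  exact tendsto_nhds_unique tendsto_const_nhds hlim

theorem fourierT_fourierInv (G : 𝓢(ℝ, ℂ)) (γ : ℝ) :
    fourierT (𝓕⁻ G : 𝓢(ℝ, ℂ)) γ = G (γ / (2 * Real.pi)) := by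
  have h : (𝓕 (𝓕⁻ G : 𝓢(ℝ, ℂ)) : 𝓢(ℝ, ℂ)) (γ / (2 * Real.pi)) = G (γ / (2 * Real.pi)) := by
    rw [FourierTransform.fourier_fourierInv_eq]
  rw [← h, SchwartzMap.fourier_coe, Real.fourier_real_eq_integral_exp_smul, fourierT]
  refine integral_congr_ae (ae_of_all _ fun t => ?_)
  simp only [smul_eq_mul]
  rw [mul_comm]
  congr 2
  push_cast
  field_simp

theorem smear_fourierInv_dilate {x : X} (G H : 𝓢(ℝ, ℂ)) {μ : ℝ} (hμ : 0 < μ)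
    (hH : ∀ w, H w = G (μ * w)) :
    smear α (𝓕⁻ H : 𝓢(ℝ, ℂ)) x = dilAvg α (𝓕⁻ G : 𝓢(ℝ, ℂ)) μ x := by
  have hinv : ∀ t, (𝓕⁻ H : 𝓢(ℝ, ℂ)) t = μ⁻¹ • (𝓕⁻ G : 𝓢(ℝ, ℂ)) (μ⁻¹ * t) := by
    intro t
    rw [SchwartzMap.fourierInv_coe, SchwartzMap.fourierInv_coe, Real.fourierInv_eq',
      Real.fourierInv_eq', ← abs_of_pos (inv_pos.2 hμ), ← Measure.integral_comp_mul_left]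
    refine integral_congr_ae (ae_of_all _ fun w => ?_)
    simp only [hH, abs_of_pos (inv_pos.2 hμ), RCLike.inner_apply, conj_trivial]
    congr 5
    field_simp
  rw [smear, dilAvg]
  have h := Measure.integral_comp_mul_left
    (fun t => (𝓕⁻ G : 𝓢(ℝ, ℂ)) (μ⁻¹ * t) • α t x) μ
  simp only [inv_mul_cancel_left₀ hμ.ne', abs_of_pos (inv_pos.2 hμ)] at h
  rw [h, ← integral_smul]
  refine integral_congr_ae (ae_of_all _ fun t => ?_)
  simp only [hinv, smul_assoc]

/-- All smearings of `x` by functions with compact spectrum inside `U` vanish. -/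
def SmearVanishes (α : ℝ → X → X) (U : Set ℝ) (x : X) : Prop :=
  ∀ f : ℝ → ℂ, Integrable f → IsCompact (tsupport (fourierT f)) →
    tsupport (fourierT f) ⊆ U → smear α f x = 0

theorem SmearVanishes.smear_fourierInv {U F : Set ℝ} {x : X} (hx : SmearVanishes α U x)
    (hF : IsClosed F) (hFU : ∀ w ∈ F, 2 * Real.pi * w ∈ U) (G : 𝓢(ℝ, ℂ))
    (hG : HasCompactSupport G) (hGF : ∀ w ∉ F, G w = 0) :
    smear α (𝓕⁻ G : 𝓢(ℝ, ℂ)) x = 0 := by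
  have hpi : (2 * Real.pi)⁻¹ ≠ 0 := by positivity
  have he : fourierT (𝓕⁻ G : 𝓢(ℝ, ℂ)) = G ∘ Homeomorph.mulLeft₀ (2 * Real.pi)⁻¹ hpi := by
    funext γ
    rw [fourierT_fourierInv, div_eq_inv_mul]; rfl
  have hGs : tsupport G ⊆ F :=
    closure_minimal (fun w hw => by by_contra h; exact hw (hGF w h)) hF
  refine hx _ (𝓕⁻ G : 𝓢(ℝ, ℂ)).integrable ?_ ?_
  · rw [he, tsupport_comp_eq_preimage]
    exact (Homeomorph.isCompact_preimage _).2 hG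
  · rw [he, tsupport_comp_eq_preimage]
    intro γ hγ
    have := hFU _ (hGs hγ)
    change 2 * Real.pi * ((2 * Real.pi)⁻¹ * γ) ∈ U at this
    rwa [mul_inv_cancel_left₀ (by positivity)] at this

theorem IsCStarDynSys.smear_fourierInv_eq_zero (hα : IsCStarDynSys α) {x : X}
    (hp : SmearVanishes α (Ioi 0) x) (hn : SmearVanishes α (Iio 0) x) (G : 𝓢(ℝ, ℂ))
    (hG : HasCompactSupport G) {ν : ℝ} (hν : 0 < ν) (hG0 : ∀ w, |w| < ν → G w = 0) :
    smear α (𝓕⁻ G : 𝓢(ℝ, ℂ)) x = 0 := by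
  let S : ℝ → ℂ := fun w => (Real.smoothTransition (w / ν) : ℂ)
  have hS : ContDiff ℝ ∞ S := Complex.ofRealCLM.contDiff.comp
    (Real.smoothTransition.contDiff.comp (contDiff_id.div_const ν))
  have hGc : ContDiff ℝ ∞ G := G.smooth _
  have hc₁ : HasCompactSupport fun w => G w * S w := hG.mul_right
  have hc₂ : HasCompactSupport fun w => G w * (1 - S w) := hG.mul_right
  let G₁ : 𝓢(ℝ, ℂ) := hc₁.toSchwartzMap (hGc.mul hS)
  let G₂ : 𝓢(ℝ, ℂ) := hc₂.toSchwartzMap (hGc.mul (contDiff_const.sub hS))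
  have hsum : G = G₁ + G₂ := by
    ext w
    change G w = G w * S w + G w * (1 - S w)
    ring
  have h₁ : smear α (𝓕⁻ G₁ : 𝓢(ℝ, ℂ)) x = 0 := by
    refine hp.smear_fourierInv (F := Ici ν) isClosed_Ici ?_ G₁ hc₁ ?_
    · intro w hw
      have : 0 < w := hν.trans_le hw
      exact mem_Ioi.2 (by positivity)
    · intro w hw
      change G w * S w = 0
      rw [mem_Ici, not_le] at hw
      rcases le_or_gt w 0 with h | h
      · simp [S, Real.smoothTransition.zero_of_nonpos (div_nonpos_of_nonpos_of_nonneg h hν.le)]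
      · rw [hG0 w (by rwa [abs_of_pos h]), zero_mul]
  have h₂ : smear α (𝓕⁻ G₂ : 𝓢(ℝ, ℂ)) x = 0 := by
    refine hn.smear_fourierInv (F := Iic (-ν)) isClosed_Iic ?_ G₂ hc₂ ?_
    · intro w hw
      have : w < 0 := lt_of_le_of_lt hw (by linarith)
      exact mul_neg_of_pos_of_neg (by positivity) this
    · intro w hw
      change G w * (1 - S w) = 0
      rw [mem_Iic, not_le] at hw
      rcases le_or_gt ν w with h | h
      · simp [S, Real.smoothTransition.one_of_one_le ((one_le_div hν).2 h)]
      · rw [hG0 w (abs_lt.2 ⟨hw, h⟩), zero_mul]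
  have hadd : ((𝓕⁻ G : 𝓢(ℝ, ℂ)) : ℝ → ℂ) =
      fun t => (𝓕⁻ G₁ : 𝓢(ℝ, ℂ)) t + (𝓕⁻ G₂ : 𝓢(ℝ, ℂ)) t := by
    rw [hsum, FourierTransform.fourierInv_add]; rfl
  rw [hadd, hα.smear_add_fun (SchwartzMap.integrable _) (SchwartzMap.integrable _), h₁, h₂,
    add_zero]

theorem exists_schwartz_bump : ∃ G : 𝓢(ℝ, ℂ), HasCompactSupport G ∧ ∀ w, |w| ≤ 1 → G w = 1 := by
  let b : ContDiffBump (0 : ℝ) := ⟨1, 2, one_pos, one_lt_two⟩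
  have hc : HasCompactSupport fun w => (b w : ℂ) :=
    b.hasCompactSupport.comp_left (g := ((↑) : ℝ → ℂ)) Complex.ofReal_zero
  refine ⟨hc.toSchwartzMap (Complex.ofRealCLM.contDiff.comp b.contDiff), hc, fun w hw => ?_⟩
  change (b w : ℂ) = 1
  rw [b.one_of_mem_closedBall (by simpa using hw), Complex.ofReal_one]

theorem integral_fourierInv (G : 𝓢(ℝ, ℂ)) : ∫ t, (𝓕⁻ G : 𝓢(ℝ, ℂ)) t = G 0 := by
  have := fourierT_fourierInv G 0
  simpa [fourierT] using this

/-- An element without spectrum outside `0` is a fixed point. -/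
theorem IsCStarDynSys.mem_fixedPts_of_smearVanishes (hα : IsCStarDynSys α) {x : X}
    (hp : SmearVanishes α (Ioi 0) x) (hn : SmearVanishes α (Iio 0) x) : x ∈ fixedPts α := by
  obtain ⟨G, hG, hG1⟩ := exists_schwartz_bump
  have hk1 : ∫ t, (𝓕⁻ G : 𝓢(ℝ, ℂ)) t = 1 := by rw [integral_fourierInv, hG1 0 (by simp)]
  have hconst : ∀ μ > 0, dilAvg α (𝓕⁻ G : 𝓢(ℝ, ℂ)) μ x = dilAvg α (𝓕⁻ G : 𝓢(ℝ, ℂ)) 1 x := by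
    intro μ hμ
    have hHc : HasCompactSupport fun w => G (μ * w) :=
      hG.comp_homeomorph (Homeomorph.mulLeft₀ μ hμ.ne')
    let H : 𝓢(ℝ, ℂ) := hHc.toSchwartzMap ((G.smooth _).comp (contDiff_const.mul contDiff_id))
    have hH : ∀ w, H w = G (μ * w) := fun w => rfl
    rw [← smear_fourierInv_dilate G H hμ hH,
      ← smear_fourierInv_dilate G G one_pos (fun w => by rw [one_mul])]
    have hD : smear α (𝓕⁻ (H - G) : 𝓢(ℝ, ℂ)) x = 0 := by
      refine hα.smear_fourierInv_eq_zero hp hn (H - G) (hHc.sub hG)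
        (ν := min μ⁻¹ 1) (by positivity) fun w hw => ?_
      rw [lt_min_iff] at hw
      rw [sub_apply, hH, hG1 w hw.2.le, hG1, sub_self]
      rw [abs_mul, abs_of_pos hμ]
      have := mul_le_mul_of_nonneg_left hw.1.le hμ.le
      rwa [mul_inv_cancel₀ hμ.ne'] at this
    have hadd : ((𝓕⁻ H : 𝓢(ℝ, ℂ)) : ℝ → ℂ) =
        fun t => (𝓕⁻ (H - G) : 𝓢(ℝ, ℂ)) t + (𝓕⁻ G : 𝓢(ℝ, ℂ)) t := by
      conv_lhs => rw [← sub_add_cancel H G, FourierTransform.fourierInv_add]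
      rfl
    rw [hadd, hα.smear_add_fun (SchwartzMap.integrable _) (SchwartzMap.integrable _), hD,
      zero_add]
  have hx : dilAvg α (𝓕⁻ G : 𝓢(ℝ, ℂ)) 1 x = x := by
    have h := (hα.tendsto_dilAvg_zero (𝓕⁻ G : 𝓢(ℝ, ℂ)).integrable hk1 x).mono_left
      (nhdsWithin_le_nhds (s := Ioi 0))
    refine tendsto_nhds_unique (tendsto_const_nhds.congr' ?_) h
    filter_upwards [self_mem_nhdsWithin] with μ hμ using (hconst μ hμ).symm
  intro s
  have h := hα.tendsto_map_dilAvg_sub (𝓕⁻ G : 𝓢(ℝ, ℂ)) s x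
  have h0 : α s x - x = 0 := by
    refine tendsto_nhds_unique (tendsto_const_nhds.congr' ?_) h
    filter_upwards [eventually_gt_atTop 0] with μ hμ
    rw [hconst μ hμ, hx]
  exact sub_eq_zero.1 h0

theorem IsCStarDynSys.smear_eq_zero_of_mem_fixedPts (hα : IsCStarDynSys α) {f : ℝ → ℂ}
    (hf : Integrable f) (h0 : (0 : ℝ) ∉ tsupport (fourierT f)) {x : X}
    (hx : smear α f x ∈ fixedPts α) : smear α f x = 0 := by
  obtain ⟨G, -, hG1⟩ := exists_schwartz_bump
  refine hα.smear_eq_zero_of_fixed (𝓕⁻ G) (by rw [integral_fourierInv, hG1 0 (by simp)]) hf ?_ hx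
  simpa [fourierT] using image_eq_zero_of_notMem_tsupport h0

end Kernel

section Corner

variable {α : ℝ → X → X}

/-- If the corner of `X` cut out by `specO U` is fixed pointwise, then `specO U` squares to zero. -/
theorem IsCStarDynSys.mul_eq_zero_of_corner_fixed (hα : IsCStarDynSys α) {U V : Set ℝ}
    (hU : (0 : ℝ) ∉ U) (hUV : ∀ γ ∈ U, -γ ∈ V)
    (h : ∀ a ∈ specO α univ V, ∀ x, ∀ b ∈ specO α univ U, a * x * b ∈ fixedPts α) {a b : X}
    (ha : a ∈ specO α univ U) (hb : b ∈ specO α univ U) : a * b = 0 := by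
  refine closedSpan_induction (p := fun b => a * b = 0)
    (isClosed_eq (continuous_const.mul continuous_id) continuous_const) ?_ ?_ ?_ ?_ hb
  · rintro b ⟨x, -, f, hf, hc, hs, hbx⟩
    have hb : b ∈ specO α univ U := subset_closedSpan _ ⟨x, mem_univ _, f, hf, hc, hs, hbx⟩
    have ha' := star_mem_specO hα hUV ha
    have hm : star a * (a * star a) * a ∈ fixedPts α := h _ ha' _ _ ha
    have hmb : star a * (a * star a) * a * b = 0 := by
      have hfix : star a * (a * star a) * a * b ∈ fixedPts α := by
        rw [mul_assoc (star a), mul_assoc (star a)]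
        simpa only [mul_assoc] using h _ ha' (a * star a * a) _ hb
      rw [hbx, hα.mul_smear_of_fixed hf hm] at hfix ⊢
      exact hα.smear_eq_zero_of_mem_fixedPts hf (fun h => hU (hs h)) hfix
    have h1 : star a * a * b = 0 := by
      rw [← CStarRing.star_mul_self_eq_zero_iff]
      have : star (star a * a * b) * (star a * a * b) =
          star b * (star a * (a * star a) * a * b) := by
        simp only [star_mul, star_star, mul_assoc]
      rw [this, hmb, mul_zero]
    rw [← CStarRing.star_mul_self_eq_zero_iff]
    have : star (a * b) * (a * b) = star b * (star a * a * b) := by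
      simp only [star_mul, mul_assoc]
    rw [this, h1, mul_zero]
  · exact mul_zero a
  · intro x y hx hy; rw [mul_add, hx, hy, add_zero]
  · intro c x hx; rw [mul_smul_comm, hx, smul_zero]

/-- If the corner of `X` cut out by `specO U` is fixed pointwise, then so is the corner cut out by
the adjoint space `specO V`. -/
theorem IsCStarDynSys.corner_fixed_of_corner_fixed (hα : IsCStarDynSys α) {U V : Set ℝ}
    (hU : (0 : ℝ) ∉ U) (hUV : ∀ γ ∈ U, -γ ∈ V) (hVU : ∀ γ ∈ V, -γ ∈ U)
    (hcover : (U = Ioi 0 ∧ V = Iio 0) ∨ (U = Iio 0 ∧ V = Ioi 0))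
    (h : ∀ a ∈ specO α univ V, ∀ x, ∀ b ∈ specO α univ U, a * x * b ∈ fixedPts α) {a b : X} (x : X)
    (ha : a ∈ specO α univ U) (hb : b ∈ specO α univ V) : a * x * b ∈ fixedPts α := by
  have hUU : ∀ c ∈ specO α univ U, ∀ d ∈ specO α univ U, c * d = 0 :=
    fun c hc d hd => hα.mul_eq_zero_of_corner_fixed hU hUV h hc hd
  have hVV : ∀ c ∈ specO α univ V, ∀ d ∈ specO α univ V, c * d = 0 := by
    intro c hc d hd
    rw [← star_eq_zero, star_mul]
    exact hUU _ (star_mem_specO hα hVU hd) _ (star_mem_specO hα hVU hc)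
  have hvU : SmearVanishes α U (a * x * b) := by
    intro f hf hc hs
    have hy : smear α f (a * x * b) ∈ specO α univ U :=
      subset_closedSpan _ ⟨_, mem_univ _, f, hf, hc, hs, rfl⟩
    rw [← CStarRing.mul_star_self_eq_zero_iff, hα.smear_mul hf]
    refine integral_eq_zero_of_ae (ae_of_all _ fun t => ?_)
    have hyb := star_mem_specO hα hUV hy
    simp only [hα.map_mul, Pi.zero_apply]
    rw [mul_assoc (α t a * α t x), hVV _ (map_mem_specO hα hb t) _ hyb]
    simp
  have hvV : SmearVanishes α V (a * x * b) := by
    intro f hf hc hs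
    have hy : smear α f (a * x * b) ∈ specO α univ V :=
      subset_closedSpan _ ⟨_, mem_univ _, f, hf, hc, hs, rfl⟩
    rw [← CStarRing.star_mul_self_eq_zero_iff, hα.mul_smear hf]
    refine integral_eq_zero_of_ae (ae_of_all _ fun t => ?_)
    simp only [hα.map_mul, ← mul_assoc, Pi.zero_apply]
    rw [hUU _ (star_mem_specO hα hVU hy) _ (map_mem_specO hα ha t)]
    simp
  rcases hcover with ⟨rfl, rfl⟩ | ⟨rfl, rfl⟩
  · exact hα.mem_fixedPts_of_smearVanishes hvU hvV
  · exact hα.mem_fixedPts_of_smearVanishes hvV hvU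

theorem IsCStarDynSys.closedSpan_subset_fixedPts (hα : IsCStarDynSys α) {S : Set X}
    (hS : S ⊆ fixedPts α) : ClosedSpan S ⊆ fixedPts α := fun _ hx =>
  closedSpan_induction (p := fun x => x ∈ fixedPts α) hα.isClosed_fixedPts hS hα.map_zero
    (fun x y hx hy t => by rw [hα.map_add, hx, hy]) (fun c x hx t => by rw [hα.map_smulc, hx]) hx

theorem closedSpan_subset_ideal {Y S : Set X} (hY : IsClosedTwoSidedIdealIn univ Y)
    (hS : S ⊆ Y) : ClosedSpan S ⊆ Y := fun _ hx =>
  closedSpan_induction (p := fun x => x ∈ Y) hY.2.1 hS hY.2.2.1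
    (fun x y hx hy => hY.2.2.2.1 x hx y hy) (fun c x hx => hY.2.2.2.2.1 c x hx) hx

theorem IsCStarDynSys.specO_subset (hα : IsCStarDynSys α) {Y : Set X}
    (hY : IsClosedTwoSidedIdealIn univ Y) (hYinv : Invariant α Y) (U : Set ℝ) :
    specO α Y U ⊆ Y := by
  refine closedSpan_subset_ideal hY ?_
  rintro _ ⟨y, hy, f, hf, -, -, rfl⟩
  let M : Submodule ℂ X :=
    { carrier := Y
      add_mem' := fun {x y} hx hy => hY.2.2.2.1 x hx y hy
      zero_mem' := hY.2.2.1
      smul_mem' := hY.2.2.2.2.1 }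
  exact hα.smear_mem hf M hY.2.1 fun t => hYinv t y hy

end Corner

/-- **Remark 4.12.** Under maximality of `X^α([0,∞))`, with `Y` the `α`-simple ideal of
Lemma 4.10, the closed span of `X^α((−∞,0)) X X^α((0,∞))` is contained in
`Y^α = Y ∩ X^α` if and only if the closed span of `X^α((0,∞)) X X^α((−∞,0))` is. -/
theorem span_neg_pos_subset_iff (α : ℝ → X → X) (hα : IsCStarDynSys α)
    (hnontrivial : actSpec α (univ : Set X) ≠ ({0} : Set ℝ))
    (hmax : IsMaximalClosedSubalgebra (specC α (Ici (0 : ℝ))))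
    (Y : Set X) (hY : IsClosedTwoSidedIdealIn (univ : Set X) Y)
    (hYinv : Invariant α Y) (hYsimple : AlphaSimple α Y)
    (hYpos : specO α Y (Ioi (0 : ℝ)) = specO α (univ : Set X) (Ioi (0 : ℝ)))
    (hYdense : closure (Y + specC α (Ici (0 : ℝ))) = (univ : Set X)) :
    ClosedSpan (MulSet3 (specO α (univ : Set X) (Iio (0 : ℝ))) (univ : Set X)
        (specO α (univ : Set X) (Ioi (0 : ℝ)))) ⊆ Y ∩ fixedPts α ↔
    ClosedSpan (MulSet3 (specO α (univ : Set X) (Ioi (0 : ℝ))) (univ : Set X)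
        (specO α (univ : Set X) (Iio (0 : ℝ)))) ⊆ Y ∩ fixedPts α := by
  have hP : specO α univ (Ioi (0 : ℝ)) ⊆ Y := hYpos ▸ hα.specO_subset hY hYinv _
  have hmem : ∀ {U V : Set ℝ} {a x b : X}, a ∈ specO α univ U → b ∈ specO α univ V →
      a * x * b ∈ ClosedSpan (MulSet3 (specO α univ U) univ (specO α univ V)) :=
    fun ha hb => subset_closedSpan _ ⟨_, ha, _, mem_univ _, _, hb, rfl⟩
  constructor
  · intro h
    refine subset_inter (closedSpan_subset_ideal hY ?_) (hα.closedSpan_subset_fixedPts ?_)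
    · rintro _ ⟨a, ha, x, -, b, -, rfl⟩
      rw [mul_assoc]
      exact (hY.2.2.2.2.2 (x * b) (mem_univ _) a (hP ha)).2
    · rintro _ ⟨a, ha, x, -, b, hb, rfl⟩
      exact hα.corner_fixed_of_corner_fixed (U := Ioi 0) (V := Iio 0) (by simp) (by simp)
        (by simp) (Or.inl ⟨rfl, rfl⟩) (fun a ha x b hb => (h (hmem ha hb)).2) x ha hb
  · intro h
    refine subset_inter (closedSpan_subset_ideal hY ?_) (hα.closedSpan_subset_fixedPts ?_)
    · rintro _ ⟨a, -, x, -, b, hb, rfl⟩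
      exact (hY.2.2.2.2.2 (a * x) (mem_univ _) b (hP hb)).1
    · rintro _ ⟨a, ha, x, -, b, hb, rfl⟩
      exact hα.corner_fixed_of_corner_fixed (U := Iio 0) (V := Ioi 0) (by simp) (by simp)
        (by simp) (Or.inr ⟨rfl, rfl⟩) (fun a ha x b hb => (h (hmem ha hb)).2) x ha hb


end PeligradMax
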